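/- arXiv:2302.10261 — 7 statements merged into one kernel-verified Lean document; each statement's English description precedes it below -/
import Mathlib

section
/- Fix a budget B ∈ ℝ and suppose π* ∈ Π satisfies Cost(π*) ≤ B, TP(π*) > 0, and F₁(π) ≤ F₁(π*) for every π ∈ Π with Cost(π) ≤ B (i.e., π* maximizes the F₁ score subject to the budget constraint). Then π* maximizes the true negative rate subject to the budget constraint and a true-positive constraint: for every π ∈ Π with Cost(π) ≤ B and TP(π) ≥ TP(π*), one has TN(π) ≤ TN(π*). -/
/-- If `π*` maximizes the F₁ score `2·TP/(1 + TP − TN)` subject to a budget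
constraint `Cost ≤ B` and has `TP(π*) > 0`, then `π*` maximizes the true negative rate
subject to the budget constraint and the constraint `TP(π) ≥ TP(π*)`. -/
theorem f1_opt_maximizes_tn {Pol : Type*} [Nonempty Pol] (TP TN Cost : Pol → ℝ)
    (hTP : ∀ π, 0 ≤ TP π) (hTN : ∀ π, 0 ≤ TN π) (hsum : ∀ π, TP π + TN π ≤ 1)
    (B : ℝ) (πs : Pol) (hBs : Cost πs ≤ B) (hpos : 0 < TP πs)
    (hopt : ∀ π, Cost π ≤ B →
      2 * TP π / (1 + TP π - TN π) ≤ 2 * TP πs / (1 + TP πs - TN πs)) :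
    ∀ π, Cost π ≤ B → TP πs ≤ TP π → TN π ≤ TN πs := by
  intro p hp hle
  have h := hopt p hp
  have h1 := hsum p
  have h2 := hsum πs
  have h3 := hTP πs
  rw [div_le_div_iff₀ (by linarith) (by linarith)] at h
  have h4 : TP πs * (1 - TN πs) ≤ TP p * (1 - TN πs) :=
    mul_le_mul_of_nonneg_right hle (by linarith)
  have h5 : TP πs * TN p ≤ TP πs * TN πs := by linarith
  exact le_of_mul_le_mul_left h5 hpos
end

section
/- Define the cost–F₁ Pareto front Π* = {π* ∈ Π : TP(π*) > 0 and there exists B > 0 with Cost(π*) ≤ B such that F₁(π) ≤ F₁(π*) for all π ∈ Π with Cost(π) ≤ B}. Then Π* is contained in the union, over all B > 0 and K ∈ [0, 1], of the sets {π* ∈ Π : Cost(π*) ≤ B, TP(π*) ≥ K, and TN(π) ≤ TN(π*) for every π ∈ Π with Cost(π) ≤ B and TP(π) ≥ K}. -/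
/-- The cost–F₁ Pareto front is contained in the union, over budgets `B > 0`
and thresholds `K ∈ [0,1]`, of the sets of policies maximizing the true negative rate
subject to the budget constraint `Cost ≤ B` and the true-positive constraint `TP ≥ K`. -/
theorem pareto_front_subset {Pol : Type*} [Nonempty Pol] (TP TN Cost : Pol → ℝ)
    (hTP : ∀ π, 0 ≤ TP π) (hTN : ∀ π, 0 ≤ TN π) (hsum : ∀ π, TP π + TN π ≤ 1) :
    {πs : Pol | 0 < TP πs ∧ ∃ B > 0, Cost πs ≤ B ∧ ∀ π, Cost π ≤ B →
        2 * TP π / (1 + TP π - TN π) ≤ 2 * TP πs / (1 + TP πs - TN πs)} ⊆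
      ⋃ B > (0 : ℝ), ⋃ K ∈ Set.Icc (0 : ℝ) 1,
        {πs : Pol | Cost πs ≤ B ∧ K ≤ TP πs ∧
          ∀ π, Cost π ≤ B → K ≤ TP π → TN π ≤ TN πs} := by 
  rintro s ⟨hs, B, hB, hc, hmax⟩
  simp only [Set.mem_iUnion]
  refine ⟨B, hB, TP s, ⟨hTP s, by linarith [hTN s, hsum s]⟩, hc, le_refl _, ?_⟩
  intro p hp hK
  by_contra! hlt
  have h := hmax p hp
  have h1 := hsum p
  have h2 := hsum s
  rw [div_le_div_iff₀ (by linarith) (by linarith)] at h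
  have h3 : TP s * (1 - TN s) ≤ TP p * (1 - TN s) :=
    mul_le_mul_of_nonneg_right hK (by linarith)
  have h4 : TP s * TN s < TP s * TN p := mul_lt_mul_of_pos_left hlt hs
  linarith
end

section
/- Let K, B ∈ ℝ and suppose v* ∈ V satisfies v*₂ ≥ K, v*₃ ≤ B, and v₁ ≤ v*₁ for every v ∈ V with v₂ ≥ K and v₃ ≤ B (i.e., v* maximizes the first coordinate over the polytope subject to the two linear constraints). Then there exist Lagrange multipliers λ ≥ 0 and ρ ≤ 0 such that v₁ + λ·v₂ + ρ·v₃ ≤ v*₁ + λ·v*₂ + ρ·v*₃ for every v ∈ V. -/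
/-- One-variable elimination step. -/
lemma fm_step {E : Type*} (S : Set E) (hS : S.Finite) (α c : E → ℝ)
    (h0 : ∀ p ∈ S, c p = 0 → α p ≤ 0)
    (h1 : ∀ p ∈ S, ∀ q ∈ S, 0 < c p → c q < 0 → c p * α q - c q * α p ≤ 0) :
    ∃ r : ℝ, ∀ p ∈ S, α p + c p * r ≤ 0 := by
  classical
  set g : E → ℝ := fun p => -α p / c p with hg
  have hU : ((g '' {p ∈ S | 0 < c p})).Finite := (hS.subset (Set.sep_subset _ _)).image _
  have hL : ((g '' {p ∈ S | c p < 0})).Finite := (hS.subset (Set.sep_subset _ _)).image _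
  have hLU : ∀ p ∈ S, ∀ q ∈ S, 0 < c p → c q < 0 → g q ≤ g p := by
    intro p hp q hq hcp hcq
    have := h1 p hp q hq hcp hcq
    have e1 : g q = α q / (-c q) := by simp [hg, neg_div, div_neg]
    rw [e1]
    simp only [hg]
    rw [div_le_div_iff₀ (by linarith) hcp]
    nlinarith
  have key : ∃ r : ℝ, (∀ p ∈ S, 0 < c p → r ≤ g p) ∧ (∀ q ∈ S, c q < 0 → g q ≤ r) := by
    by_cases hne : ∃ q ∈ S, c q < 0
    · obtain ⟨q0, hq0, hc0⟩ := hne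
      obtain ⟨m, ⟨q, ⟨hq, hcq⟩, rfl⟩, hmax⟩ :=
        Set.exists_max_image (g '' {p ∈ S | c p < 0}) id hL ⟨_, q0, ⟨hq0, hc0⟩, rfl⟩
      exact ⟨g q, fun p hp hcp => hLU p hp q hq hcp hcq,
        fun q' hq' hc' => hmax _ ⟨q', ⟨hq', hc'⟩, rfl⟩⟩
    · obtain ⟨r, hr⟩ := hU.bddBelow
      exact ⟨r, fun p hp hcp => hr ⟨p, ⟨hp, hcp⟩, rfl⟩,
        fun q hq hcq => (hne ⟨q, hq, hcq⟩).elim⟩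
  obtain ⟨r, hr1, hr2⟩ := key
  refine ⟨r, fun p hp => ?_⟩
  rcases lt_trichotomy (c p) 0 with h | h | h
  · have := hr2 p hp h
    simp only [hg] at this
    rw [div_le_iff_of_neg h] at this
    linarith
  · have := h0 p hp h
    rw [h]; linarith
  · have := hr1 p hp h
    simp only [hg] at this
    rw [le_div_iff₀ h] at this
    linarith

/-- Farkas alternative for two unknowns, relative to a cone `D` containing the constraints. -/
lemma fm_two (D S : Set (Fin 3 → ℝ)) (hS : S.Finite) (hSD : S ⊆ D)
    (hD : ∀ p ∈ D, ∀ q ∈ D, ∀ s t : ℝ, 0 ≤ s → 0 ≤ t → s • p + t • q ∈ D)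
    (hbad : ∀ p ∈ D, p 1 = 0 → p 2 = 0 → p 0 ≤ 0) :
    ∃ l r : ℝ, ∀ p ∈ S, p 0 + p 1 * l + p 2 * r ≤ 0 := by
  set S' : Set (Fin 3 → ℝ) := {p ∈ S | p 2 = 0} ∪
    Set.image2 (fun p q : Fin 3 → ℝ => p 2 • q + (-q 2) • p) {p ∈ S | 0 < p 2} {q ∈ S | q 2 < 0}
    with hS'
  have hfin : S'.Finite := (hS.subset (Set.sep_subset _ _)).union
    (Set.Finite.image2 _ (hS.subset (Set.sep_subset _ _)) (hS.subset (Set.sep_subset _ _)))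
  have hS'D : ∀ p ∈ S', p ∈ D ∧ p 2 = 0 := by
    rintro p (⟨hp, h2⟩ | ⟨p, ⟨hp, hp2⟩, q, ⟨hq, hq2⟩, rfl⟩)
    · exact ⟨hSD hp, h2⟩
    · refine ⟨hD _ (hSD hq) _ (hSD hp) _ _ hp2.le (by linarith), ?_⟩
      simp; ring
  obtain ⟨l, hl⟩ : ∃ l : ℝ, ∀ p ∈ S', p 0 + p 1 * l ≤ 0 := by
    refine fm_step S' hfin (fun p => p 0) (fun p => p 1) ?_ ?_
    · intro p hp h
      exact hbad p (hS'D p hp).1 h (hS'D p hp).2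
    · intro p hp q hq hp1 hq1
      have := hbad _ (hD q (hS'D q hq).1 p (hS'D p hp).1 (p 1) (-q 1) hp1.le
        (by linarith)) (by simp; ring)
        (by simp [(hS'D p hp).2, (hS'D q hq).2])
      simp at this ⊢
      linarith
  refine ⟨l, fm_step S hS (fun p => p 0 + p 1 * l) (fun p => p 2) ?_ ?_⟩
  · intro p hp h
    exact hl p (Or.inl ⟨hp, h⟩)
  · intro p hp q hq hp2 hq2
    have := hl _ (Or.inr ⟨p, ⟨hp, hp2⟩, q, ⟨hq, hq2⟩, rfl⟩)
    simp at this ⊢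
    linarith

/-- Lagrange multipliers for maximizing the first coordinate over a convex
polytope in ℝ³ subject to `v₂ ≥ K` and `v₃ ≤ B`. If `v*` is constrained-optimal, then
there exist `λ ≥ 0` and `ρ ≤ 0` such that `v*` maximizes `v₁ + λ·v₂ + ρ·v₃` over the
whole polytope. -/
theorem lp_lagrange_multipliers (F : Set (Fin 3 → ℝ)) (hFfin : F.Finite)
    (hFne : F.Nonempty) (K B : ℝ) (vs : Fin 3 → ℝ) (hvs : vs ∈ convexHull ℝ F)
    (hK : K ≤ vs 1) (hB : vs 2 ≤ B)
    (hopt : ∀ v ∈ convexHull ℝ F, K ≤ v 1 → v 2 ≤ B → v 0 ≤ vs 0) :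
    ∃ lam : ℝ, 0 ≤ lam ∧ ∃ rho : ℝ, rho ≤ 0 ∧
      ∀ v ∈ convexHull ℝ F,
        v 0 + lam * v 1 + rho * v 2 ≤ vs 0 + lam * vs 1 + rho * vs 2 := by
  set D : Set (Fin 3 → ℝ) := {d | ∃ t : ℝ, 0 ≤ t ∧ ∃ v ∈ convexHull ℝ F,
    d 0 = t * (v 0 - vs 0) ∧ d 1 ≤ t * (v 1 - vs 1) ∧ d 2 ≤ -(t * (v 2 - vs 2))} with hDdef
  set S : Set (Fin 3 → ℝ) :=
    (fun f : Fin 3 → ℝ => ![f 0 - vs 0, f 1 - vs 1, -(f 2 - vs 2)]) '' F ∪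
      {![0, -1, 0], ![0, 0, -1]} with hSdef
  have hS : S.Finite := (hFfin.image _).union (Set.toFinite _)
  have hSD : S ⊆ D := by
    rintro d (⟨f, hf, rfl⟩ | rfl | rfl)
    · exact ⟨1, zero_le_one, f, subset_convexHull ℝ F hf, by simp, by simp, by simp⟩
    · exact ⟨0, le_rfl, vs, hvs, by simp, by simp, by simp⟩
    · exact ⟨0, le_rfl, vs, hvs, by simp, by simp, by simp⟩
  have hD : ∀ p ∈ D, ∀ q ∈ D, ∀ s t : ℝ, 0 ≤ s → 0 ≤ t → s • p + t • q ∈ D := by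
    rintro p ⟨a, ha, v, hv, hp0, hp1, hp2⟩ q ⟨b, hb, w, hw, hq0, hq1, hq2⟩ s t hs ht
    have hA : 0 ≤ s * a := mul_nonneg hs ha
    have hB' : 0 ≤ t * b := mul_nonneg ht hb
    have p1 := mul_le_mul_of_nonneg_left hp1 hs
    have p2 := mul_le_mul_of_nonneg_left hp2 hs
    have q1 := mul_le_mul_of_nonneg_left hq1 ht
    have q2 := mul_le_mul_of_nonneg_left hq2 ht
    have hcomb : ∃ u ∈ convexHull ℝ F, ∀ i,
        (s * a + t * b) * (u i - vs i) = s * (a * (v i - vs i)) + t * (b * (w i - vs i)) := by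
      rcases (add_nonneg hA hB').eq_or_lt with h | h
      · have h1 : s * a = 0 := by linarith
        have h2 : t * b = 0 := by linarith
        refine ⟨vs, hvs, fun i => ?_⟩
        rw [← mul_assoc, ← mul_assoc, h1, h2]; ring
      · refine ⟨(s * a / (s * a + t * b)) • v + (t * b / (s * a + t * b)) • w,
          convex_convexHull ℝ F hv hw (by positivity) (by positivity)
            (by rw [← add_div, div_self h.ne']), fun i => ?_⟩
        have := h.ne'
        simp only [Pi.add_apply, Pi.smul_apply, smul_eq_mul]
        field_simp
        ring
    obtain ⟨u, hu, hui⟩ := hcomb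
    refine ⟨s * a + t * b, add_nonneg hA hB', u, hu, ?_, ?_, ?_⟩
    · rw [hui]; simp [hp0, hq0]
    · rw [hui]; simp only [Pi.add_apply, Pi.smul_apply, smul_eq_mul]; linarith
    · rw [hui]; simp only [Pi.add_apply, Pi.smul_apply, smul_eq_mul]; linarith
  have hbad : ∀ p ∈ D, p 1 = 0 → p 2 = 0 → p 0 ≤ 0 := by
    rintro p ⟨t, ht, v, hv, h0, h1, h2⟩ e1 e2
    rcases ht.eq_or_lt with h | h
    · rw [h0, ← h]; simp
    · rw [e1] at h1
      rw [e2] at h2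
      have k1 : 0 ≤ v 1 - vs 1 := nonneg_of_mul_nonneg_right h1 h
      have k2 : 0 ≤ -(v 2 - vs 2) := nonneg_of_mul_nonneg_right (by linarith) h
      have := hopt v hv (by linarith) (by linarith)
      rw [h0]
      exact mul_nonpos_of_nonneg_of_nonpos h.le (by linarith)
  obtain ⟨l, r, hlr⟩ := fm_two D S hS hSD hD hbad
  have hl := hlr ![0, -1, 0] (Or.inr (Or.inl rfl))
  have hr := hlr ![0, 0, -1] (Or.inr (Or.inr rfl))
  simp at hl hr
  refine ⟨l, hl, -r, by linarith, ?_⟩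
  have hconv : Convex ℝ {v : Fin 3 → ℝ |
      v 0 + l * v 1 + -r * v 2 ≤ vs 0 + l * vs 1 + -r * vs 2} := by
    intro x hx y hy a b ha hb hab
    simp only [Set.mem_setOf_eq, Pi.add_apply, Pi.smul_apply, smul_eq_mul] at *
    have h1 := mul_le_mul_of_nonneg_left hx ha
    have h2 := mul_le_mul_of_nonneg_left hy hb
    have h3 : b = 1 - a := by linarith
    subst h3
    linarith
  refine fun v hv => convexHull_min ?_ hconv hv
  intro f hf
  have := hlr _ (Or.inl ⟨f, hf, rfl⟩)
  simp at this ⊢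
  linarith
end

section
/- Let K, B ∈ ℝ and suppose v* ∈ V satisfies v*₂ ≥ K, v*₃ ≤ B, and v₁ ≤ v*₁ for every v ∈ V with v₂ ≥ K and v₃ ≤ B. Then there exist λ ≥ 0 and ρ ≤ 0 such that v₁ + λ·v₂ + ρ·v₃ ≤ v*₁ + λ·v*₂ + ρ·v*₃ for every v ∈ V, and moreover the complementary slackness conditions λ·(v*₂ − K) = 0 and ρ·(v*₃ − B) = 0 hold. -/
/-- One-variable elimination step. -/
lemma elim_one {α : Type*} (S : Finset α) (d c : α → ℝ)
    (h0 : ∀ p ∈ S, c p = 0 → d p ≤ 0)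
    (h1 : ∀ p ∈ S, ∀ q ∈ S, 0 < c p → c q < 0 → c p * d q - c q * d p ≤ 0) :
    ∃ x : ℝ, ∀ p ∈ S, d p + x * c p ≤ 0 := by
  classical
  have key : ∃ x : ℝ, (∀ p ∈ S, 0 < c p → x ≤ -d p / c p) ∧
      (∀ q ∈ S, c q < 0 → -d q / c q ≤ x) := by
    by_cases hN : (S.filter (fun q => c q < 0)).Nonempty
    · obtain ⟨q, hq, hmax⟩ := Finset.exists_max_image _ (fun q => -d q / c q) hN
      rw [Finset.mem_filter] at hq
      refine ⟨-d q / c q, fun p hp hcp => ?_, fun q' hq' hc' =>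
        hmax q' (Finset.mem_filter.2 ⟨hq', hc'⟩)⟩
      rw [div_le_iff_of_neg hq.2, div_mul_eq_mul_div, div_le_iff₀ hcp]
      nlinarith [h1 p hp q hq.1 hcp hq.2]
    · by_cases hP : (S.filter (fun q => 0 < c q)).Nonempty
      · obtain ⟨q, hq, hmin⟩ := Finset.exists_min_image _ (fun q => -d q / c q) hP
        refine ⟨-d q / c q, fun p hp hcp => hmin p (Finset.mem_filter.2 ⟨hp, hcp⟩),
          fun q' hq' hc' => (hN ⟨q', Finset.mem_filter.2 ⟨hq', hc'⟩⟩).elim⟩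
      · exact ⟨0, fun p hp hcp => (hP ⟨p, Finset.mem_filter.2 ⟨hp, hcp⟩⟩).elim,
          fun q' hq' hc' => (hN ⟨q', Finset.mem_filter.2 ⟨hq', hc'⟩⟩).elim⟩
  obtain ⟨x, hx1, hx2⟩ := key
  refine ⟨x, fun p hp => ?_⟩
  rcases lt_trichotomy (c p) 0 with h | h | h
  · have := hx2 p hp h
    rw [div_le_iff_of_neg h] at this
    linarith
  · have := h0 p hp h
    rw [h]; linarith
  · have := hx1 p hp h
    rw [le_div_iff₀ h] at this
    linarith

/-- Two-variable Farkas lemma. -/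
lemma farkas_two (S : Finset (ℝ × ℝ × ℝ)) (D : Set (ℝ × ℝ × ℝ))
    (hadd : ∀ p ∈ D, ∀ q ∈ D, p + q ∈ D)
    (hsmul : ∀ r : ℝ, 0 ≤ r → ∀ p ∈ D, r • p ∈ D)
    (hS : ∀ p ∈ S, p ∈ D)
    (hD : ∀ p ∈ D, p.2.1 = 0 → p.2.2 = 0 → p.1 ≤ 0) :
    ∃ x y : ℝ, ∀ p ∈ S, p.1 + x * p.2.1 + y * p.2.2 ≤ 0 := by
  classical
  let g : (ℝ × ℝ × ℝ) × (ℝ × ℝ × ℝ) → ℝ × ℝ × ℝ :=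
    fun z => z.1.2.2 • z.2 + (-z.2.2.2) • z.1
  let S1 := S.filter (fun p => p.2.2 = 0)
  let S2 := ((S ×ˢ S).filter (fun z => 0 < z.1.2.2 ∧ z.2.2.2 < 0)).image g
  have hT : ∀ p ∈ S1 ∪ S2, p ∈ D ∧ p.2.2 = 0 := by
    intro p hp
    rcases Finset.mem_union.1 hp with hp | hp
    · have := Finset.mem_filter.1 hp
      exact ⟨hS p this.1, this.2⟩
    · obtain ⟨z, hz, rfl⟩ := Finset.mem_image.1 hp
      obtain ⟨hz, h1, h2⟩ := Finset.mem_filter.1 hz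
      obtain ⟨hz1, hz2⟩ := Finset.mem_product.1 hz
      refine ⟨hadd _ (hsmul _ h1.le _ (hS _ hz2)) _ (hsmul _ (by linarith) _ (hS _ hz1)), ?_⟩
      simp only [g, Prod.snd_add, Prod.smul_snd, smul_eq_mul]
      ring
  obtain ⟨x, hx⟩ := elim_one (S1 ∪ S2) (fun p => p.1) (fun p => p.2.1)
    (fun p hp h => hD p (hT p hp).1 h (hT p hp).2)
    (by
      intro p hp q hq hcp hcq
      have hm := hadd _ (hsmul _ hcp.le _ (hT q hq).1) _
        (hsmul (-q.2.1) (by linarith) _ (hT p hp).1)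
      have := hD _ hm
        (by simp only [Prod.snd_add, Prod.fst_add, Prod.smul_snd, Prod.smul_fst, smul_eq_mul]; ring)
        (by simp only [Prod.snd_add, Prod.smul_snd, smul_eq_mul, (hT q hq).2, (hT p hp).2]; ring)
      simp only [Prod.fst_add, Prod.smul_fst, smul_eq_mul] at this
      linarith)
  obtain ⟨y, hy⟩ := elim_one S (fun p => p.1 + x * p.2.1) (fun p => p.2.2)
    (fun p hp h => hx p (Finset.mem_union_left _ (Finset.mem_filter.2 ⟨hp, h⟩)))
    (by
      intro p hp q hq hcp hcq
      have := hx (g (p, q)) (Finset.mem_union_right _ (Finset.mem_image_of_mem _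
        (Finset.mem_filter.2 ⟨Finset.mem_product.2 ⟨hp, hq⟩, hcp, hcq⟩)))
      simp only [g, Prod.snd_add, Prod.fst_add, Prod.smul_snd, Prod.smul_fst, smul_eq_mul] at this
      linarith)
  exact ⟨x, y, hy⟩

/-- Lagrange multipliers with complementary slackness for maximizing the
first coordinate over a convex polytope in ℝ³ subject to `v₂ ≥ K` and `v₃ ≤ B`. -/
theorem lp_lagrange_complementary_slackness (F : Set (Fin 3 → ℝ)) (hFfin : F.Finite)
    (hFne : F.Nonempty) (K B : ℝ) (vs : Fin 3 → ℝ) (hvs : vs ∈ convexHull ℝ F)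
    (hK : K ≤ vs 1) (hB : vs 2 ≤ B)
    (hopt : ∀ v ∈ convexHull ℝ F, K ≤ v 1 → v 2 ≤ B → v 0 ≤ vs 0) :
    ∃ lam : ℝ, 0 ≤ lam ∧ ∃ rho : ℝ, rho ≤ 0 ∧
      (∀ v ∈ convexHull ℝ F,
        v 0 + lam * v 1 + rho * v 2 ≤ vs 0 + lam * vs 1 + rho * vs 2) ∧
      lam * (vs 1 - K) = 0 ∧ rho * (vs 2 - B) = 0 := by
  classical
  let e : (Fin 3 → ℝ) → ℝ × ℝ × ℝ := fun v => (v 0 - vs 0, v 1 - K, B - v 2)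
  let D : Set (ℝ × ℝ × ℝ) := {p | ∃ t : ℝ, 0 ≤ t ∧ ∃ v ∈ convexHull ℝ F,
    p.1 ≤ t * (v 0 - vs 0) ∧ p.2.1 ≤ t * (v 1 - K) ∧ p.2.2 ≤ t * (B - v 2)}
  obtain ⟨x, y, hxy⟩ := farkas_two
    (insert (0, -1, 0) (insert (0, 0, -1) (hFfin.toFinset.image e))) D
    (by
      rintro p ⟨t, ht, v, hv, h1, h2, h3⟩ q ⟨s, hs, w, hw, k1, k2, k3⟩
      rcases (add_nonneg ht hs).eq_or_lt with h | h
      · have ht0 : t = 0 := by linarith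
        have hs0 : s = 0 := by linarith
        subst ht0 hs0
        refine ⟨0, le_rfl, v, hv, ?_, ?_, ?_⟩ <;>
          simp only [Prod.fst_add, Prod.snd_add] <;> linarith
      · refine ⟨t + s, h.le, (t / (t + s)) • v + (s / (t + s)) • w,
          convex_convexHull ℝ F hv hw (by positivity) (by positivity) (by field_simp), ?_⟩
        have hh : ∀ i, (t + s) * ((t / (t + s)) • v + (s / (t + s)) • w) i = t * v i + s * w i := by
          intro i
          simp only [Pi.add_apply, Pi.smul_apply, smul_eq_mul]
          field_simp
        refine ⟨?_, ?_, ?_⟩ <;>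
          rw [mul_sub, hh] <;> simp only [Prod.fst_add, Prod.snd_add] <;> linarith)
    (by
      rintro r hr p ⟨t, ht, v, hv, h1, h2, h3⟩
      refine ⟨r * t, mul_nonneg hr ht, v, hv, ?_, ?_, ?_⟩ <;>
        simp only [Prod.smul_fst, Prod.smul_snd, smul_eq_mul, mul_assoc] <;> gcongr)
    (by
      intro p hp
      simp only [Finset.mem_insert, Finset.mem_image, Set.Finite.mem_toFinset] at hp
      rcases hp with rfl | rfl | ⟨v, hv, rfl⟩
      · exact ⟨0, le_rfl, vs, hvs, by simp, by simp, by simp⟩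
      · exact ⟨0, le_rfl, vs, hvs, by simp, by simp, by simp⟩
      · exact ⟨1, zero_le_one, v, subset_convexHull ℝ F hv, by simp [e], by simp [e], by simp [e]⟩)
    (by
      rintro p ⟨t, ht, v, hv, h1, h2, h3⟩ e1 e2
      rw [e1] at h2
      rw [e2] at h3
      rcases ht.eq_or_lt with rfl | ht
      · linarith
      · have a1 := nonneg_of_mul_nonneg_right h2 ht
        have a2 := nonneg_of_mul_nonneg_right h3 ht
        have := hopt v hv (by linarith) (by linarith)
        nlinarith)
  have hx : 0 ≤ x := by
    have := hxy (0, -1, 0) (by simp)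
    simp only at this
    linarith
  have hy : 0 ≤ y := by
    have := hxy (0, 0, -1) (by simp)
    simp only at this
    linarith
  have hV : ∀ v ∈ convexHull ℝ F, v 0 - vs 0 + x * (v 1 - K) + y * (B - v 2) ≤ 0 := by
    have hc : Convex ℝ {v : Fin 3 → ℝ | v 0 - vs 0 + x * (v 1 - K) + y * (B - v 2) ≤ 0} := by
      intro v hv w hw a b ha hb hab
      simp only [Set.mem_setOf_eq, Pi.add_apply, Pi.smul_apply, smul_eq_mul] at *
      have hb' : b = 1 - a := by linarith
      have := mul_nonpos_of_nonneg_of_nonpos ha hv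
      have := mul_nonpos_of_nonneg_of_nonpos hb hw
      subst hb'
      linarith
    refine fun v hv => convexHull_min (fun f hf => ?_) hc hv
    refine hxy (e f) ?_
    simp only [Finset.mem_insert, Finset.mem_image, Set.Finite.mem_toFinset]
    exact Or.inr (Or.inr ⟨f, hf, rfl⟩)
  have hs := hV vs hvs
  have p1 := mul_nonneg hx (sub_nonneg.2 hK)
  have p2 := mul_nonneg hy (sub_nonneg.2 hB)
  refine ⟨x, hx, -y, by linarith, fun v hv => ?_, by linarith, by linarith⟩
  have := hV v hv
  linarith
end

section
/- Let K, B ∈ ℝ and assume the constrained problem is feasible, i.e., there exists v ∈ V with v₂ ≥ K and v₃ ≤ B. Then minimax duality holds: sup{v₁ : v ∈ V, v₂ ≥ K, v₃ ≤ B} = inf{ s ∈ ℝ : there exist λ ≥ 0 and ρ ≤ 0 with s = sup{v₁ + λ·(v₂ − K) + ρ·(v₃ − B) : v ∈ V} }. -/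
/-- Minimax (LP) duality over a convex polytope in ℝ³: if the constrained
problem is feasible, the optimal constrained value of `v₁` equals the infimum over
multipliers `λ ≥ 0`, `ρ ≤ 0` of the maximum of the Lagrangian over the polytope. -/
theorem lp_minimax_duality (F : Set (Fin 3 → ℝ)) (hFfin : F.Finite) (hFne : F.Nonempty)
    (K B : ℝ) (hfeas : ∃ v ∈ convexHull ℝ F, K ≤ v 1 ∧ v 2 ≤ B) :
    sSup {x : ℝ | ∃ v ∈ convexHull ℝ F, K ≤ v 1 ∧ v 2 ≤ B ∧ x = v 0} =
      sInf {s : ℝ | ∃ lam : ℝ, 0 ≤ lam ∧ ∃ rho : ℝ, rho ≤ 0 ∧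
        s = sSup {x : ℝ | ∃ v ∈ convexHull ℝ F,
          x = v 0 + lam * (v 1 - K) + rho * (v 2 - B)}} := by 
  classical
  have hcomp : IsCompact (convexHull ℝ F) := hFfin.isCompact_convexHull (𝕜 := ℝ)
  have hconv : Convex ℝ (convexHull ℝ F) := convex_convexHull ℝ F
  have hbdd : ∀ lam rho : ℝ, BddAbove {x : ℝ | ∃ v ∈ convexHull ℝ F,
      x = v 0 + lam * (v 1 - K) + rho * (v 2 - B)} := by
    intro lam rho
    have hc : Continuous (fun v : Fin 3 → ℝ => v 0 + lam * (v 1 - K) + rho * (v 2 - B)) := by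
      fun_prop
    obtain ⟨M, hM⟩ := (hcomp.image hc).bddAbove
    refine ⟨M, ?_⟩
    rintro x ⟨v, hv, rfl⟩
    exact hM ⟨v, hv, rfl⟩
  have hbddP : BddAbove {x : ℝ | ∃ v ∈ convexHull ℝ F, K ≤ v 1 ∧ v 2 ≤ B ∧ x = v 0} := by
    obtain ⟨M, hM⟩ := hbdd 0 0
    refine ⟨M, ?_⟩
    rintro x ⟨v, hv, -, -, rfl⟩
    exact hM ⟨v, hv, by ring⟩
  obtain ⟨w, hw, hw1, hw2⟩ := hfeas
  have hweak : ∀ s ∈ {s : ℝ | ∃ lam : ℝ, 0 ≤ lam ∧ ∃ rho : ℝ, rho ≤ 0 ∧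
        s = sSup {x : ℝ | ∃ v ∈ convexHull ℝ F,
          x = v 0 + lam * (v 1 - K) + rho * (v 2 - B)}},
      sSup {x : ℝ | ∃ v ∈ convexHull ℝ F, K ≤ v 1 ∧ v 2 ≤ B ∧ x = v 0} ≤ s := by
    rintro s ⟨lam, hl, rho, hr, rfl⟩
    refine csSup_le ⟨w 0, w, hw, hw1, hw2, rfl⟩ ?_
    rintro x ⟨v, hv, hv1, hv2, rfl⟩
    have h1 := le_csSup (hbdd lam rho) ⟨v, hv, rfl⟩
    have h2 : 0 ≤ lam * (v 1 - K) := mul_nonneg hl (by linarith)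
    have h3 : 0 ≤ rho * (v 2 - B) := mul_nonneg_of_nonpos_of_nonpos hr (by linarith)
    linarith
  apply le_antisymm
  · exact le_csInf ⟨_, 0, le_refl _, 0, le_refl _, rfl⟩ hweak
  · apply le_of_forall_pos_le_add
    intro e he
    set p := sSup {x : ℝ | ∃ v ∈ convexHull ℝ F, K ≤ v 1 ∧ v 2 ≤ B ∧ x = v 0} with hp
    have hple : ∀ v ∈ convexHull ℝ F, K ≤ v 1 → v 2 ≤ B → v 0 ≤ p := fun v hv h1 h2 =>
      le_csSup hbddP ⟨v, hv, h1, h2, rfl⟩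
    let T : Set (Fin 3 → ℝ) := {t | p + e ≤ t 0 ∧ K ≤ t 1 ∧ t 2 ≤ B}
    have hTc : IsClosed T := by
      refine IsClosed.and ?_ (IsClosed.and ?_ ?_)
      · exact isClosed_le (by fun_prop) (by fun_prop)
      · exact isClosed_le (by fun_prop) (by fun_prop)
      · exact isClosed_le (by fun_prop) (by fun_prop)
    have hTconv : Convex ℝ T := by
      rintro x ⟨hx0, hx1, hx2⟩ y ⟨hy0, hy1, hy2⟩ a b ha hb hab
      obtain rfl : b = 1 - a := by linarith
      refine ⟨?_, ?_, ?_⟩ <;> simp only [Pi.add_apply, Pi.smul_apply, smul_eq_mul] <;> nlinarith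
    have hdisj : Disjoint (convexHull ℝ F) T := by
      rw [Set.disjoint_left]
      rintro v hv ⟨h0, h1, h2⟩
      linarith [hple v hv h1 h2]
    obtain ⟨f, u, u', hfu, huu, hfT⟩ :=
      geometric_hahn_banach_compact_closed hconv hcomp hTconv hTc hdisj
    have hf : ∀ v : Fin 3 → ℝ, f v = v 0 * f (Pi.single 0 1) + v 1 * f (Pi.single 1 1)
        + v 2 * f (Pi.single 2 1) := by
      intro v
      have hv : v = v 0 • (Pi.single 0 1 : Fin 3 → ℝ) + v 1 • (Pi.single 1 1 : Fin 3 → ℝ)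
          + v 2 • (Pi.single 2 1 : Fin 3 → ℝ) := by
        ext i; fin_cases i <;> simp
      conv_lhs => rw [hv]
      simp only [map_add, map_smul, smul_eq_mul]
    generalize f (Pi.single 0 1) = a at hf
    generalize f (Pi.single 1 1) = b at hf
    generalize f (Pi.single 2 1) = c at hf
    have hT : ∀ x y z : ℝ, 0 ≤ x → 0 ≤ y → 0 ≤ z →
        u < (p + e + x) * a + (K + y) * b + (B - z) * c := by
      intro x y z hx hy hz
      have h := hfT ![p + e + x, K + y, B - z] ⟨by simp [hx], by simp [hy], by simp [hz]⟩
      rw [hf] at h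
      simp at h
      linarith
    have key : ∀ q r : ℝ, (∀ x : ℝ, 0 ≤ x → u < q + x * r) → 0 ≤ r := by
      intro q r h
      by_contra! hr
      have h0 := h 0 le_rfl
      have h1 := h ((u - q) / r) (div_nonneg_of_nonpos (by linarith) hr.le)
      rw [div_mul_cancel₀ _ hr.ne] at h1
      linarith
    have hb : 0 ≤ b := key ((p + e) * a + K * b + B * c) b fun x hx => by
      have := hT 0 x 0 le_rfl hx le_rfl
      linarith
    have hc : 0 ≤ -c := key ((p + e) * a + K * b + B * c) (-c) fun x hx => by
      have := hT 0 0 x le_rfl le_rfl hx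
      linarith
    have hV : ∀ v ∈ convexHull ℝ F, v 0 * a + v 1 * b + v 2 * c < u := fun v hv => by
      have := hfu v hv
      rwa [hf] at this
    have h0 := hT 0 0 0 le_rfl le_rfl le_rfl
    have ha : 0 < a := by
      have h1 := hV w hw
      have h2 := hple w hw hw1 hw2
      have h3 : 0 < (p + e - w 0) * a := by nlinarith
      exact (mul_pos_iff_of_pos_left (by linarith)).1 h3
    have hmem : sInf {s : ℝ | ∃ lam : ℝ, 0 ≤ lam ∧ ∃ rho : ℝ, rho ≤ 0 ∧
        s = sSup {x : ℝ | ∃ v ∈ convexHull ℝ F,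
          x = v 0 + lam * (v 1 - K) + rho * (v 2 - B)}} ≤
        sSup {x : ℝ | ∃ v ∈ convexHull ℝ F,
          x = v 0 + (b / a) * (v 1 - K) + (c / a) * (v 2 - B)} :=
      csInf_le ⟨p, hweak⟩ ⟨b / a, div_nonneg hb ha.le, c / a,
        div_nonpos_of_nonpos_of_nonneg (by linarith) ha.le, rfl⟩
    refine hmem.trans (csSup_le ⟨_, w, hw, rfl⟩ ?_)
    rintro x ⟨v, hv, rfl⟩
    have h1 := hV v hv
    have h2 : v 0 + b / a * (v 1 - K) + c / a * (v 2 - B)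
        = (v 0 * a + b * (v 1 - K) + c * (v 2 - B)) / a := by
      field_simp
    rw [h2, div_le_iff₀ ha]
    linarith
end

section
/- Assume 0 ≤ v₁, 0 ≤ v₂ and v₁ + v₂ ≤ 1 for every v ∈ V, and define the F₁ score of v ∈ V as F₁(v) = 2·v₂/(1 + v₂ − v₁). Define the cost–F₁ Pareto front Π* = {v* ∈ V : v*₂ > 0 and there exists B > 0 with v*₃ ≤ B such that F₁(v) ≤ F₁(v*) for all v ∈ V with v₃ ≤ B}. Then Π* is contained in the set of all reward-shaped solutions: Π* ⊆ {v* ∈ V : there exist λ ≥ 0 and ρ ≤ 0 such that v₁ + λ·v₂ + ρ·v₃ ≤ v*₁ + λ·v*₂ + ρ·v*₃ for every v ∈ V}. -/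
/-- The cost–F₁ Pareto front over a convex polytope in ℝ³ (coordinates
interpreted as (TN, TP, Cost), with `0 ≤ v₁`, `0 ≤ v₂`, `v₁ + v₂ ≤ 1` on the polytope,
and F₁ score `2·v₂/(1 + v₂ − v₁)`) is contained in the set of reward-shaped solutions. -/
theorem pareto_front_subset_shaped (F : Set (Fin 3 → ℝ)) (hFfin : F.Finite)
    (hFne : F.Nonempty)
    (hTN : ∀ v ∈ convexHull ℝ F, 0 ≤ v 0) (hTP : ∀ v ∈ convexHull ℝ F, 0 ≤ v 1)
    (hsum : ∀ v ∈ convexHull ℝ F, v 0 + v 1 ≤ 1) :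
    {vs : Fin 3 → ℝ | vs ∈ convexHull ℝ F ∧ 0 < vs 1 ∧ ∃ B > 0, vs 2 ≤ B ∧
        ∀ v ∈ convexHull ℝ F, v 2 ≤ B →
          2 * v 1 / (1 + v 1 - v 0) ≤ 2 * vs 1 / (1 + vs 1 - vs 0)} ⊆
      {vs : Fin 3 → ℝ | vs ∈ convexHull ℝ F ∧ ∃ lam : ℝ, 0 ≤ lam ∧ ∃ rho : ℝ, rho ≤ 0 ∧
        ∀ v ∈ convexHull ℝ F,
          v 0 + lam * v 1 + rho * v 2 ≤ vs 0 + lam * vs 1 + rho * vs 2} := by 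
  rintro w ⟨hw, hp, B, hB, hwB, hopt⟩
  refine ⟨hw, (1 - w 0) / w 1, ?_, ?_⟩
  · have := hsum w hw
    exact div_nonneg (by linarith) hp.le
  have hkey : ∀ v ∈ convexHull ℝ F, v 2 ≤ B → v 0 + (1 - w 0) / w 1 * v 1 ≤ 1 := by
    intro v hv hvB
    have h := hopt v hv hvB
    have h0 := hTP v hv
    have h1 := hsum v hv
    have h2 := hsum w hw
    have e : v 0 + (1 - w 0) / w 1 * v 1 = (v 0 * w 1 + (1 - w 0) * v 1) / w 1 := by
      field_simp
    rw [e, div_le_one hp]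
    rcases (show 0 ≤ 1 + v 1 - v 0 by linarith).eq_or_lt with hD | hD
    · have hv1 : v 1 = 0 := by linarith
      have hv0 : v 0 = 1 := by linarith
      rw [hv1, hv0]; linarith
    · rw [div_le_div_iff₀ hD (by linarith)] at h
      nlinarith
  have hgw : w 0 + (1 - w 0) / w 1 * w 1 = 1 := by
    field_simp; ring
  generalize (1 - w 0) / w 1 = lam at hkey hgw
  obtain ⟨m, hm, hmax⟩ := Set.exists_max_image F
    (fun f => if B < f 2 then max 0 ((f 0 + lam * f 1 - 1) / (f 2 - B)) else 0) hFfin hFne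
  obtain ⟨mu, hmu⟩ : ∃ mu, mu =
    (if B < m 2 then max 0 ((m 0 + lam * m 1 - 1) / (m 2 - B)) else 0) := ⟨_, rfl⟩
  simp only [← hmu] at hmax
  have hmu0 : 0 ≤ mu := by
    rw [hmu]; split_ifs
    · exact le_max_left _ _
    · exact le_rfl
  have hmucase : mu = 0 ∨ (B < m 2 ∧ mu = (m 0 + lam * m 1 - 1) / (m 2 - B)) := by
    by_cases hc : B < m 2
    · rw [if_pos hc] at hmu
      rcases max_choice 0 ((m 0 + lam * m 1 - 1) / (m 2 - B)) with h | h
      · left; rw [hmu, h]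
      · right; exact ⟨hc, by rw [hmu, h]⟩
    · left; rw [hmu, if_neg hc]
  have hF : ∀ f ∈ F, f 0 + lam * f 1 - 1 ≤ mu * (f 2 - B) := by
    intro f hf
    have hfV := subset_convexHull ℝ F hf
    have hmV := subset_convexHull ℝ F hm
    by_cases hc : B < f 2
    · have h := hmax f hf
      rw [if_pos hc] at h
      have h' := (le_max_right _ _).trans h
      rwa [div_le_iff₀ (by linarith)] at h'
    · push Not at hc
      rcases hmucase with h | ⟨hmB, h⟩
      · rw [h]; linarith [hkey f hfV hc]
      · have hd : 0 < m 2 - f 2 := by linarith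
        have hcomb := convex_convexHull ℝ F hfV hmV
          (a := (m 2 - B) / (m 2 - f 2)) (b := (B - f 2) / (m 2 - f 2))
          (div_nonneg (by linarith) hd.le) (div_nonneg (by linarith) hd.le)
          (by field_simp; ring)
        have hk := hkey _ hcomb (by
          simp only [Pi.add_apply, Pi.smul_apply, smul_eq_mul]
          apply le_of_eq; field_simp; ring)
        simp only [Pi.add_apply, Pi.smul_apply, smul_eq_mul] at hk
        have e : (m 2 - B) / (m 2 - f 2) * f 0 + (B - f 2) / (m 2 - f 2) * m 0 +
            lam * ((m 2 - B) / (m 2 - f 2) * f 1 + (B - f 2) / (m 2 - f 2) * m 1) =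
            ((m 2 - B) * (f 0 + lam * f 1) + (B - f 2) * (m 0 + lam * m 1)) / (m 2 - f 2) := by
          field_simp; ring
        rw [e, div_le_one hd] at hk
        have hmB' : 0 < m 2 - B := by linarith
        rw [h, div_mul_eq_mul_div, le_div_iff₀ hmB']
        nlinarith
  refine ⟨-mu, by linarith, ?_⟩
  have hconv : Convex ℝ {v : Fin 3 → ℝ | v 0 + lam * v 1 - 1 ≤ mu * (v 2 - B)} := by
    intro x hx y hy a b ha hb hab
    simp only [Set.mem_setOf_eq, Pi.add_apply, Pi.smul_apply, smul_eq_mul] at *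
    have h1 := mul_le_mul_of_nonneg_left hx ha
    have h2 := mul_le_mul_of_nonneg_left hy hb
    have hb' : b = 1 - a := by linarith
    subst hb'
    nlinarith
  intro v hv
  have h : v 0 + lam * v 1 - 1 ≤ mu * (v 2 - B) := convexHull_min hF hconv hv
  have h2 := mul_le_mul_of_nonneg_left hwB hmu0
  nlinarith
end

section
/- Let λ ≥ 0 and B ∈ ℝ, and suppose v* ∈ V satisfies v*₃ ≤ B and v₁ + λ·v₂ ≤ v*₁ + λ·v*₂ for every v ∈ V with v₃ ≤ B (i.e., v* maximizes the linear metric TN + λ·TP over the polytope subject to the budget constraint). Then there exists ρ ≤ 0 such that v₁ + λ·v₂ + ρ·v₃ ≤ v*₁ + λ·v*₂ + ρ·v*₃ for every v ∈ V. -/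
/-- Lagrange multiplier for the budget constraint when maximizing the
linear metric `v₁ + λ·v₂` over a convex polytope in ℝ³ subject to `v₃ ≤ B`: if `v*` is
constrained-optimal, there exists `ρ ≤ 0` such that `v*` maximizes
`v₁ + λ·v₂ + ρ·v₃` over the whole polytope. -/
theorem linear_metric_lagrange (F : Set (Fin 3 → ℝ)) (hFfin : F.Finite)
    (hFne : F.Nonempty) (lam B : ℝ) (hlam : 0 ≤ lam) (vs : Fin 3 → ℝ)
    (hvs : vs ∈ convexHull ℝ F) (hB : vs 2 ≤ B)
    (hopt : ∀ v ∈ convexHull ℝ F, v 2 ≤ B → v 0 + lam * v 1 ≤ vs 0 + lam * vs 1) :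
    ∃ rho : ℝ, rho ≤ 0 ∧ ∀ v ∈ convexHull ℝ F,
      v 0 + lam * v 1 + rho * v 2 ≤ vs 0 + lam * vs 1 + rho * vs 2 := by
  set g : (Fin 3 → ℝ) → ℝ := fun v => v 0 + lam * v 1 - (vs 0 + lam * vs 1) with hg
  have hg0 : g vs = 0 := by simp [hg]
  have hgle : ∀ v ∈ convexHull ℝ F, v 2 ≤ B → g v ≤ 0 := by
    intro v hv h
    have := hopt v hv h
    simp only [hg]
    linarith
  have key : ∀ a ∈ convexHull ℝ F, ∀ b ∈ convexHull ℝ F, a 2 ≤ B → B < b 2 →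
      (b 2 - B) * g a + (B - a 2) * g b ≤ 0 := by
    intro a ha b hb h1 h2
    have hd : 0 < b 2 - a 2 := by linarith
    have hmem := convex_convexHull ℝ F ha hb
      (div_nonneg (by linarith : 0 ≤ b 2 - B) hd.le)
      (div_nonneg (by linarith : 0 ≤ B - a 2) hd.le)
      (by field_simp; ring)
    have h3 := hgle _ hmem (by
      simp only [Pi.add_apply, Pi.smul_apply, smul_eq_mul]
      apply le_of_eq
      field_simp
      ring)
    have h4 : g (((b 2 - B) / (b 2 - a 2)) • a + ((B - a 2) / (b 2 - a 2)) • b)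
        = ((b 2 - B) * g a + (B - a 2) * g b) / (b 2 - a 2) := by
      simp only [hg, Pi.add_apply, Pi.smul_apply, smul_eq_mul]
      field_simp
      ring
    rw [h4] at h3
    by_contra hcon
    push Not at hcon
    exact absurd (div_pos hcon hd) (not_lt.mpr h3)
  rcases lt_or_eq_of_le hB with hlt | heq
  · refine ⟨0, le_rfl, fun v hv => ?_⟩
    have : g v ≤ 0 := by
      rcases le_or_gt (v 2) B with h | h
      · exact hgle v hv h
      · have := key vs hvs v hv hB h
        rw [hg0] at this
        by_contra hc
        push Not at hc
        nlinarith [mul_pos (sub_pos.mpr hlt) hc]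
    simp only [hg] at this
    linarith
  · have hS : (insert (0 : ℝ) ((fun f => g f / (f 2 - B)) '' {f ∈ F | B < f 2})).Finite :=
      ((hFfin.subset (Set.sep_subset _ _)).image _).insert 0
    obtain ⟨m, hm, hmax⟩ := Set.exists_max_image _ id hS ⟨0, Set.mem_insert _ _⟩
    simp only [id] at hmax
    have hm0 : 0 ≤ m := hmax 0 (Set.mem_insert _ _)
    have hF : ∀ f ∈ F, g f ≤ m * (f 2 - B) := by
      intro f hf
      have hfc := subset_convexHull ℝ F hf
      rcases le_or_gt (f 2) B with h | h
      · rcases hm with rfl | ⟨b, ⟨hb, hbB⟩, rfl⟩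
        · simpa using hgle f hfc h
        · have hbB' : B < b 2 := hbB
          have := key f hfc b (subset_convexHull ℝ F hb) h hbB'
          have hd : 0 < b 2 - B := by linarith
          show g f ≤ g b / (b 2 - B) * (f 2 - B)
          rw [div_mul_eq_mul_div, le_div_iff₀ hd]
          linarith
      · have := hmax _ (Set.mem_insert_of_mem _ ⟨f, ⟨hf, h⟩, rfl⟩)
        exact (div_le_iff₀ (sub_pos.mpr h)).mp this
    have hconv : Convex ℝ {v : Fin 3 → ℝ | g v ≤ m * (v 2 - B)} := by
      intro x hx y hy a b ha hb hab
      have hx' : g x ≤ m * (x 2 - B) := hx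
      have hy' : g y ≤ m * (y 2 - B) := hy
      show g (a • x + b • y) ≤ m * ((a • x + b • y) 2 - B)
      have h1 := mul_le_mul_of_nonneg_left hx' ha
      have h2 := mul_le_mul_of_nonneg_left hy' hb
      have hb' : b = 1 - a := by linarith
      subst hb'
      simp only [hg, Pi.add_apply, Pi.smul_apply, smul_eq_mul] at h1 h2 ⊢
      linarith
    refine ⟨-m, by linarith, fun v hv => ?_⟩
    have h : g v ≤ m * (v 2 - B) := convexHull_min hF hconv hv
    simp only [hg] at h
    rw [heq]
    linarith
end
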